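/- Let α > 1, Δ > 0 and σ_θ > 0. Then, as d → ∞, sup over v, w ∈ ℝ with |v − w| ≤ Δ of D_α(N(0, σ_θ² d + v²), N(0, σ_θ² d + w²)) equals αΔ²/(4dσ_θ²) + o(1/d); equivalently, lim_{d→∞} d · sup_{|v−w|≤Δ} D_α(N(0, σ_θ² d + v²), N(0, σ_θ² d + w²)) = αΔ²/(4σ_θ²). -/

import Mathlib

open MeasureTheory ProbabilityTheory Set Filter

noncomputable section

namespace Paper

open Classical in
/-- Rényi divergence of order `α` between `P` and `Q`, in the paper's convention:
`D_α(P,Q) = (1/(α−1)) log ∫ (q/p)^α dP`, where `p`, `q` are the densities of `P`, `Q`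
w.r.t. the reference (Lebesgue) measure. -/
def renyiD {E : Type*} [MeasureSpace E] (α : ℝ) (P Q : Measure E) : EReal :=
  if (∫⁻ x, (Q.rnDeriv volume x / P.rnDeriv volume x) ^ α ∂P) = ⊤ then ⊤
  else (((α - 1)⁻¹ *
    Real.log (∫⁻ x, (Q.rnDeriv volume x / P.rnDeriv volume x) ^ α ∂P).toReal : ℝ) : EReal)

theorem renyi_lintegral (α s t : ℝ) (hs : 0 < s) (ht : 0 < t)
    (hb : 0 < α * s - (α - 1) * t) :
    (∫⁻ x, ((gaussianReal 0 t.toNNReal).rnDeriv volume x /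
      (gaussianReal 0 s.toNNReal).rnDeriv volume x) ^ α ∂(gaussianReal 0 s.toNNReal)) =
    ENNReal.ofReal (((√(2 * Real.pi * s))⁻¹ * (√(2 * Real.pi * s) / √(2 * Real.pi * t)) ^ α) *
      √(Real.pi / ((α * s - (α - 1) * t) / (2 * s * t)))) := by
  have hs' : s.toNNReal ≠ 0 := by simpa using hs
  have ht' : t.toNNReal ≠ 0 := by simpa using ht
  have hac := gaussianReal_absolutelyContinuous 0 hs'
  have h1 : (∫⁻ x, ((gaussianReal 0 t.toNNReal).rnDeriv volume x /
      (gaussianReal 0 s.toNNReal).rnDeriv volume x) ^ α ∂(gaussianReal 0 s.toNNReal)) =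
      ∫⁻ x, (gaussianPDF 0 t.toNNReal x / gaussianPDF 0 s.toNNReal x) ^ α
        ∂(gaussianReal 0 s.toNNReal) := by
    apply lintegral_congr_ae
    filter_upwards [hac.ae_le (rnDeriv_gaussianReal 0 t.toNNReal),
      hac.ae_le (rnDeriv_gaussianReal 0 s.toNNReal)] with x h1 h2
    rw [h1, h2]
  rw [h1, gaussianReal_of_var_ne_zero _ hs',
    lintegral_withDensity_eq_lintegral_mul _ (measurable_gaussianPDF _ _)
      (g := fun x => (gaussianPDF 0 t.toNNReal x / gaussianPDF 0 s.toNNReal x) ^ α)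
      (((measurable_gaussianPDF _ _).div (measurable_gaussianPDF _ _)).pow_const α)]
  set b := (α * s - (α - 1) * t) / (2 * s * t) with hbdef
  have hbpos : 0 < b := by positivity
  set c := (√(2 * Real.pi * s))⁻¹ * (√(2 * Real.pi * s) / √(2 * Real.pi * t)) ^ α with hc
  rw [← integral_gaussian, ← integral_const_mul, ofReal_integral_eq_lintegral_ofReal]
  · apply lintegral_congr
    intro x
    simp only [Pi.mul_apply, gaussianPDF]
    have hp := gaussianPDFReal_pos 0 s.toNNReal x hs'
    have hq := gaussianPDFReal_pos 0 t.toNNReal x ht'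
    rw [← ENNReal.ofReal_div_of_pos hp, ENNReal.ofReal_rpow_of_pos (by positivity),
      ← ENNReal.ofReal_mul hp.le]
    congr 1
    simp only [gaussianPDFReal, Real.coe_toNNReal _ hs.le, Real.coe_toNNReal _ ht.le, sub_zero]
    have e1 : (√(2 * Real.pi * t))⁻¹ * Real.exp (-x ^ 2 / (2 * t)) /
        ((√(2 * Real.pi * s))⁻¹ * Real.exp (-x ^ 2 / (2 * s))) =
        (√(2 * Real.pi * s) / √(2 * Real.pi * t)) *
          Real.exp (-x ^ 2 / (2 * t) - -x ^ 2 / (2 * s)) := by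
      rw [Real.exp_sub]
      have : 0 < √(2 * Real.pi * t) := by positivity
      have : 0 < √(2 * Real.pi * s) := by positivity
      field_simp
    rw [e1, Real.mul_rpow (by positivity) (by positivity), ← Real.exp_mul, hc]
    have e2 : -b * x ^ 2 = -x ^ 2 / (2 * s) + (-x ^ 2 / (2 * t) - -x ^ 2 / (2 * s)) * α := by
      rw [hbdef]; field_simp; ring
    rw [e2, Real.exp_add]
    ring
  · exact (integrable_exp_neg_mul_sq hbpos).const_mul c
  · exact ae_of_all _ fun x => by simp only [Pi.zero_apply]; positivity

/-- closed form -/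
def ff (β u : ℝ) : ℝ := -(1 / 2) * (Real.log (1 + u) + β⁻¹ * Real.log (1 - β * u))

theorem renyi_eq (α s t : ℝ) (hα : 1 < α) (hs : 0 < s) (ht : 0 < t)
    (hb : 0 < 1 - (α - 1) * ((t - s) / s)) :
    renyiD α (gaussianReal 0 s.toNNReal) (gaussianReal 0 t.toNNReal) =
      ((ff (α - 1) ((t - s) / s) : ℝ) : EReal) := by
  have e : α * s - (α - 1) * t = s * (1 - (α - 1) * ((t - s) / s)) := by
    field_simp; ring
  have hb' : 0 < α * s - (α - 1) * t := by rw [e]; positivity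
  have hα' : 0 < α - 1 := by linarith
  have hpi := Real.pi_pos
  unfold renyiD
  rw [renyi_lintegral α s t hs ht hb', if_neg ENNReal.ofReal_ne_top,
    ENNReal.toReal_ofReal (by positivity)]
  congr 1
  have h1 : 1 + (t - s) / s = t / s := by field_simp; ring
  have hA : 0 < √(2 * Real.pi * s) := by positivity
  have hB : 0 < √(2 * Real.pi * t) := by positivity
  rw [e, ff, h1]
  set y := 1 - (α - 1) * ((t - s) / s) with hy
  rw [Real.log_mul (by positivity) (by positivity), Real.log_mul (by positivity) (by positivity),
    Real.log_inv, Real.log_rpow (by positivity), Real.log_div hA.ne' hB.ne',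
    Real.log_sqrt (by positivity), Real.log_sqrt (by positivity), Real.log_sqrt (by positivity),
    Real.log_div (by positivity) (by positivity), Real.log_div (by positivity) (by positivity),
    Real.log_div (by positivity) (by positivity),
    Real.log_mul (by positivity) (by positivity), Real.log_mul (by positivity) (by positivity),
    Real.log_mul (by positivity) (by positivity), Real.log_mul (by positivity) (by positivity),
    Real.log_mul (by positivity) (by positivity), Real.log_mul (by positivity) (by positivity),
    Real.log_mul two_ne_zero hs.ne']
  field_simp
  ring

theorem log_bound (x : ℝ) (h : |x| ≤ 1 / 2) : |x + x ^ 2 / 2 + Real.log (1 - x)| ≤ 2 * |x| ^ 3 := by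
  have h1 := Real.abs_log_sub_add_sum_range_le (x := x) (by linarith) 2
  simp only [Finset.sum_range_succ, Finset.sum_range_zero] at h1
  norm_num at h1
  refine h1.trans ?_
  rw [div_le_iff₀ (by linarith)]
  have : 0 ≤ |x| ^ 3 := by positivity
  nlinarith

theorem ff_bound (β u : ℝ) (hβ : 0 < β) (h : |u| ≤ 1 / 2) (h' : β * |u| ≤ 1 / 2) :
    |ff β u - (β + 1) * u ^ 2 / 4| ≤ (1 + β ^ 2) * |u| ^ 3 := by
  have h1 := log_bound (-u) (by simpa using h)
  have h2 := log_bound (β * u) (by rwa [abs_mul, abs_of_pos hβ])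
  rw [abs_neg] at h1
  rw [abs_mul, abs_of_pos hβ] at h2
  have e : ff β u - (β + 1) * u ^ 2 / 4 = -(1 / 2) * ((-u + (-u) ^ 2 / 2 + Real.log (1 - -u)) +
      β⁻¹ * (β * u + (β * u) ^ 2 / 2 + Real.log (1 - β * u))) := by
    rw [ff, sub_neg_eq_add]; field_simp; ring
  have h3 : |β⁻¹ * (β * u + (β * u) ^ 2 / 2 + Real.log (1 - β * u))| ≤ 2 * β ^ 2 * |u| ^ 3 := by
    rw [abs_mul, abs_of_pos (inv_pos.2 hβ), inv_mul_le_iff₀ hβ]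
    refine h2.trans (le_of_eq (by ring))
  rw [e, abs_mul]
  have h4 := abs_add_le (-u + (-u) ^ 2 / 2 + Real.log (1 - -u))
    (β⁻¹ * (β * u + (β * u) ^ 2 / 2 + Real.log (1 - β * u)))
  have : |(-(1 / 2) : ℝ)| = 1 / 2 := by norm_num
  rw [this]
  linarith

theorem u_bound (r Δ v w : ℝ) (hr : 0 < r) (h : |v - w| ≤ Δ) :
    |((r ^ 2 + w ^ 2) - (r ^ 2 + v ^ 2)) / (r ^ 2 + v ^ 2)| ≤ Δ / r + Δ ^ 2 / r ^ 2 := by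
  have hp : 0 < r ^ 2 + v ^ 2 := by positivity
  have hΔ : 0 ≤ Δ := (abs_nonneg _).trans h
  rw [abs_div, abs_of_pos hp, div_le_iff₀ hp]
  have e : (r ^ 2 + w ^ 2) - (r ^ 2 + v ^ 2) = (v - w) * ((v - w) - 2 * v) := by ring
  rw [e, abs_mul]
  have h1 : |(v - w) - 2 * v| ≤ Δ + 2 * |v| := by
    refine (abs_sub _ _).trans ?_
    rw [abs_mul, abs_two]; linarith
  have h2 : |v - w| * |(v - w) - 2 * v| ≤ Δ * (Δ + 2 * |v|) := by gcongr
  refine h2.trans ?_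
  have h3 : 2 * |v| ≤ (r ^ 2 + v ^ 2) / r := by
    rw [le_div_iff₀ hr]
    nlinarith [sq_nonneg (r - |v|), sq_abs v]
  have h4 : 1 ≤ (r ^ 2 + v ^ 2) / r ^ 2 := by
    rw [le_div_iff₀ (by positivity)]; nlinarith [sq_nonneg v]
  calc Δ * (Δ + 2 * |v|) = Δ ^ 2 * 1 + Δ * (2 * |v|) := by ring
    _ ≤ Δ ^ 2 * ((r ^ 2 + v ^ 2) / r ^ 2) + Δ * ((r ^ 2 + v ^ 2) / r) := by gcongr
    _ = _ := by ring

theorem lim_aux (a c K Δ σ : ℝ) (hσ : 0 < σ) :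
    Tendsto (fun d : ℕ => (d : ℝ) * (a * (Δ / (σ * √d) + c / (σ * √d) ^ 2) ^ 2 / 4 +
      K * (Δ / (σ * √d) + c / (σ * √d) ^ 2) ^ 3)) atTop (nhds (a * Δ ^ 2 / (4 * σ ^ 2))) := by
  have h0 : Tendsto (fun d : ℕ => (√(d : ℝ))⁻¹) atTop (nhds 0) :=
    tendsto_inv_atTop_zero.comp (Real.tendsto_sqrt_atTop.comp tendsto_natCast_atTop_atTop)
  have h1 : Tendsto (fun d : ℕ => a * (Δ / σ + c / σ ^ 2 * (√(d : ℝ))⁻¹) ^ 2 / 4 +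
      K * (Δ / σ + c / σ ^ 2 * (√(d : ℝ))⁻¹) ^ 3 * (√(d : ℝ))⁻¹) atTop
      (nhds (a * (Δ / σ + c / σ ^ 2 * 0) ^ 2 / 4 + K * (Δ / σ + c / σ ^ 2 * 0) ^ 3 * 0)) := by
    have h2 : Tendsto (fun d : ℕ => Δ / σ + c / σ ^ 2 * (√(d : ℝ))⁻¹) atTop
      (nhds (Δ / σ + c / σ ^ 2 * 0)) := (h0.const_mul _).const_add _
    exact (((h2.pow 2).const_mul a).div_const 4).add (((h2.pow 3).const_mul K).mul h0)
  have e : a * (Δ / σ + c / σ ^ 2 * 0) ^ 2 / 4 + K * (Δ / σ + c / σ ^ 2 * 0) ^ 3 * 0 =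
      a * Δ ^ 2 / (4 * σ ^ 2) := by field_simp; ring
  rw [e] at h1
  refine h1.congr' ?_
  filter_upwards [eventually_gt_atTop 0] with d hd
  have hd' : (0 : ℝ) < d := by exact_mod_cast hd
  have hx : 0 < √(d : ℝ) := Real.sqrt_pos.2 hd'
  have hsq : (d : ℝ) = √(d : ℝ) ^ 2 := (Real.sq_sqrt hd'.le).symm
  generalize √(d : ℝ) = x at *
  rw [hsq]
  field_simp


theorem statement18 (α Δ σθ : ℝ) (hα : 1 < α) (hΔ : 0 < Δ) (hσθ : 0 < σθ) :
    Tendsto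
      (fun d : ℕ =>
        (((d : ℝ) : EReal) *
          ⨆ p : {p : ℝ × ℝ // |p.1 - p.2| ≤ Δ},
            renyiD α (gaussianReal 0 (σθ ^ 2 * d + p.1.1 ^ 2).toNNReal)
              (gaussianReal 0 (σθ ^ 2 * d + p.1.2 ^ 2).toNNReal)))
      atTop (nhds ((α * Δ ^ 2 / (4 * σθ ^ 2) : ℝ) : EReal)) := by
  set K : ℝ := 1 + (α - 1) ^ 2 with hK
  have hα' : 0 < α - 1 := by linarith
  have hlow := lim_aux α (Δ ^ 2 / 2) (-K) Δ σθ hσθ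
  have hup := lim_aux α (Δ ^ 2) K Δ σθ hσθ
  have h0 : Tendsto (fun d : ℕ => (√(d : ℝ))⁻¹) atTop (nhds 0) :=
    tendsto_inv_atTop_zero.comp (Real.tendsto_sqrt_atTop.comp tendsto_natCast_atTop_atTop)
  have hm : Tendsto (fun d : ℕ => Δ / (σθ * √d) + Δ ^ 2 / (σθ * √d) ^ 2) atTop (nhds 0) := by
    have := (h0.const_mul (Δ / σθ)).add ((h0.pow 2).const_mul (Δ ^ 2 / σθ ^ 2))
    simp only [mul_zero, ne_eq, OfNat.ofNat_ne_zero, not_false_eq_true, zero_pow, add_zero] at this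
    refine this.congr fun d => ?_
    rw [mul_pow]
    simp only [div_eq_mul_inv, mul_inv, inv_pow]
    ring
  have hm2 : Tendsto (fun d : ℕ => (α - 1) * (Δ / (σθ * √d) + Δ ^ 2 / (σθ * √d) ^ 2)) atTop
      (nhds 0) := by simpa using hm.const_mul (α - 1)
  have key : ∀ᶠ d : ℕ in atTop, 0 < (d : ℝ) ∧ 0 < σθ * √(d : ℝ) ∧
      ∀ v w : ℝ, |v - w| ≤ Δ →
        renyiD α (gaussianReal 0 (σθ ^ 2 * d + v ^ 2).toNNReal)
              (gaussianReal 0 (σθ ^ 2 * d + w ^ 2).toNNReal) =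
          ((ff (α - 1) ((((σθ * √(d : ℝ)) ^ 2 + w ^ 2) - ((σθ * √(d : ℝ)) ^ 2 + v ^ 2)) /
            ((σθ * √(d : ℝ)) ^ 2 + v ^ 2)) : ℝ) : EReal) ∧
        |ff (α - 1) ((((σθ * √(d : ℝ)) ^ 2 + w ^ 2) - ((σθ * √(d : ℝ)) ^ 2 + v ^ 2)) /
            ((σθ * √(d : ℝ)) ^ 2 + v ^ 2)) - α * ((((σθ * √(d : ℝ)) ^ 2 + w ^ 2) -
              ((σθ * √(d : ℝ)) ^ 2 + v ^ 2)) / ((σθ * √(d : ℝ)) ^ 2 + v ^ 2)) ^ 2 / 4| ≤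
          K * |(((σθ * √(d : ℝ)) ^ 2 + w ^ 2) - ((σθ * √(d : ℝ)) ^ 2 + v ^ 2)) /
            ((σθ * √(d : ℝ)) ^ 2 + v ^ 2)| ^ 3 := by
    filter_upwards [eventually_gt_atTop 0, hm.eventually (gt_mem_nhds (by norm_num : (0:ℝ) < 1 / 2)),
      hm2.eventually (gt_mem_nhds (by norm_num : (0:ℝ) < 1 / 2))] with d hd h1 h2
    have hd' : (0 : ℝ) < d := by exact_mod_cast hd
    have hx : 0 < √(d : ℝ) := Real.sqrt_pos.2 hd'
    have hr : 0 < σθ * √(d : ℝ) := by positivity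
    refine ⟨hd', hr, fun v w hvw => ?_⟩
    have hu := u_bound _ Δ v w hr hvw
    have e : σθ ^ 2 * d = (σθ * √(d : ℝ)) ^ 2 := by rw [mul_pow, Real.sq_sqrt hd'.le]
    rw [e]
    have hu1 := hu.trans h1.le
    have hu2 := (mul_le_mul_of_nonneg_left hu hα'.le).trans h2.le
    refine ⟨renyi_eq α _ _ hα (by positivity) (by positivity) ?_, ?_⟩
    · have := mul_le_mul_of_nonneg_left (le_abs_self
        ((((σθ * √(d : ℝ)) ^ 2 + w ^ 2) - ((σθ * √(d : ℝ)) ^ 2 + v ^ 2)) /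
            ((σθ * √(d : ℝ)) ^ 2 + v ^ 2))) hα'.le
      linarith
    · have := ff_bound (α - 1) _ hα' hu1 hu2
      rwa [sub_add_cancel] at this
  refine tendsto_of_tendsto_of_tendsto_of_le_of_le'
    ((continuous_coe_real_ereal.tendsto _).comp hlow)
    ((continuous_coe_real_ereal.tendsto _).comp hup) ?_ ?_
  · filter_upwards [key] with d ⟨hd, hr, h⟩
    simp only [Function.comp]
    rw [EReal.coe_mul]
    refine mul_le_mul_of_nonneg_left ?_ (by exact_mod_cast hd.le)
    have hv : |σθ * √(d : ℝ) - (σθ * √(d : ℝ) + Δ)| ≤ Δ := by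
      rw [sub_add_cancel_left, abs_neg, abs_of_pos hΔ]
    refine le_trans ?_ (le_iSup _ ⟨(σθ * √(d : ℝ), σθ * √(d : ℝ) + Δ), hv⟩)
    obtain ⟨h1, h2⟩ := h _ _ hv
    simp only
    rw [h1, EReal.coe_le_coe_iff]
    have eu : ((σθ * √(d : ℝ)) ^ 2 + (σθ * √(d : ℝ) + Δ) ^ 2 -
        ((σθ * √(d : ℝ)) ^ 2 + (σθ * √(d : ℝ)) ^ 2)) /
        ((σθ * √(d : ℝ)) ^ 2 + (σθ * √(d : ℝ)) ^ 2) =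
        Δ / (σθ * √(d : ℝ)) + Δ ^ 2 / 2 / (σθ * √(d : ℝ)) ^ 2 := by
      generalize σθ * √(d : ℝ) = r at *
      field_simp; ring
    rw [eu] at h2 ⊢
    rw [abs_of_pos (a := Δ / (σθ * √(d : ℝ)) + Δ ^ 2 / 2 / (σθ * √(d : ℝ)) ^ 2)
      (by positivity)] at h2
    linarith [(abs_le.1 h2).1]
  · filter_upwards [key] with d ⟨hd, hr, h⟩
    simp only [Function.comp]
    rw [EReal.coe_mul]
    refine mul_le_mul_of_nonneg_left ?_ (by exact_mod_cast hd.le)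
    refine iSup_le ?_
    rintro ⟨⟨v, w⟩, hvw⟩
    obtain ⟨h1, h2⟩ := h v w hvw
    simp only
    rw [h1, EReal.coe_le_coe_iff]
    have hu := u_bound _ Δ v w hr hvw
    have h3 := (abs_le.1 h2).2
    generalize (((σθ * √(d : ℝ)) ^ 2 + w ^ 2) - ((σθ * √(d : ℝ)) ^ 2 + v ^ 2)) /
            ((σθ * √(d : ℝ)) ^ 2 + v ^ 2) = u at *
    have hKp : 0 ≤ K := by positivity
    have h4 : α * u ^ 2 / 4 ≤ α * (Δ / (σθ * √(d : ℝ)) + Δ ^ 2 / (σθ * √(d : ℝ)) ^ 2) ^ 2 / 4 := by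
      rw [← sq_abs u]; gcongr
    have h5 : K * |u| ^ 3 ≤ K * (Δ / (σθ * √(d : ℝ)) + Δ ^ 2 / (σθ * √(d : ℝ)) ^ 2) ^ 3 := by
      gcongr
    linarith

end Paper
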